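/- Let B ∈ ℝ^{n×m}, let P ∈ ℝ^{n×n} be symmetric positive definite, let ρ₁,…,ρ_m > 0, let f : ℝⁿ → ℝⁿ be Lipschitz continuous, and let γ : [0,T] → ℝ^m be a differentiable disturbance whose derivative is square-integrable on (0,T) and which satisfies |γᵢ(t)| < ρᵢ for all i and all t. Then for every x₀ ∈ ℝⁿ, the Lyapunov-based closed-loop differential inclusion ẋ(t) ∈ f(x(t)) - Σ_{i=1}^m ρᵢ·B_{•i}·sgn(B_{•i}ᵀ P x(t)) + Σ_{i=1}^m B_{•i}·γᵢ(t) a.e. on (0,T), with x(0) = x₀, has a unique Lipschitz solution on [0,T]. -/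

import Mathlib

open MeasureTheory Set
open scoped RealInnerProductSpace

noncomputable section

/-- The set-valued sign function: `sgn(x) = {1}` if `x > 0`, `{-1}` if `x < 0`,
and `[-1,1]` if `x = 0`. -/
def sgnSet (x : ℝ) : Set ℝ := if 0 < x then {1} else if x < 0 then {-1} else Icc (-1) 1

/-- Matrix-vector product, as a map between Euclidean spaces. -/
def mv {m n : ℕ} (M : Matrix (Fin m) (Fin n) ℝ) (x : EuclideanSpace ℝ (Fin n)) :
    EuclideanSpace ℝ (Fin m) := WithLp.toLp 2 fun i => ∑ j, M i j * x j

/-- The `i`-th column of a matrix, as a Euclidean vector. -/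
def col {n m : ℕ} (B : Matrix (Fin n) (Fin m) ℝ) (i : Fin m) : EuclideanSpace ℝ (Fin n) :=
  WithLp.toLp 2 fun j => B j i

/-- A Lipschitz solution on `[0,T]` of the differential inclusion `ẋ(t) ∈ F(t, x(t))`,
`x(0) = x₀`. -/
def IsLipschitzSolution {E : Type*} [NormedAddCommGroup E] [NormedSpace ℝ E]
    (F : ℝ → E → Set E) (T : ℝ) (x₀ : E) (x : ℝ → E) : Prop :=
  (∃ K : NNReal, LipschitzOnWith K x (Icc 0 T)) ∧ x 0 = x₀ ∧
    ∀ᵐ t ∂volume, t ∈ Ioo 0 T → ∃ v ∈ F t (x t), HasDerivAt x v t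

open Filter Topology

section Helpers

lemma sgnSet_bound {s a : ℝ} (h : s ∈ sgnSet a) : |s| ≤ 1 := by
  unfold sgnSet at h
  split_ifs at h
  · simp at h; simp [h]
  · simp at h; simp [h]
  · exact abs_le.2 ⟨h.1, h.2⟩

lemma sgnSet_mono {s s' a b : ℝ} (h : s ∈ sgnSet a) (h' : s' ∈ sgnSet b) :
    0 ≤ (s - s') * (a - b) := by
  have h1 := abs_le.1 (sgnSet_bound h)
  have h2 := abs_le.1 (sgnSet_bound h')
  unfold sgnSet at h h'
  split_ifs at h h' <;> simp at h h' <;> nlinarith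

lemma sgnSet_usc (r₀ : ℝ) : ∀ᶠ r in 𝓝 r₀, sgnSet r ⊆ sgnSet r₀ := by
  rcases lt_trichotomy r₀ 0 with h | h | h
  · filter_upwards [gt_mem_nhds h] with r hr
    simp [sgnSet, h, hr, not_lt.2 h.le, not_lt.2 hr.le]
  · subst h
    refine Eventually.of_forall fun r s hs => ?_
    have := abs_le.1 (sgnSet_bound hs)
    simpa [sgnSet] using this
  · filter_upwards [lt_mem_nhds h] with r hr
    simp [sgnSet, h, hr]

lemma sgnSet_convex (r : ℝ) : Convex ℝ (sgnSet r) := by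
  unfold sgnSet; split_ifs
  · exact convex_singleton _
  · exact convex_singleton _
  · exact convex_Icc _ _

lemma sgnSet_compact (r : ℝ) : IsCompact (sgnSet r) := by
  unfold sgnSet; split_ifs
  · exact isCompact_singleton
  · exact isCompact_singleton
  · exact isCompact_Icc

/-- Saturation: Lipschitz regularisation of the sign. -/
def sat (ε a : ℝ) : ℝ := max (-1) (min 1 (a / ε))

lemma sat_mem {ε : ℝ} (hε : 0 < ε) (a : ℝ) : sat ε a ∈ sgnSet (a - ε * sat ε a) := by
  have e : a = ε * (a / ε) := by field_simp
  rcases le_total 1 (a / ε) with h | h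
  · have hs : sat ε a = 1 := by simp [sat, h]
    rw [hs]
    have : 0 ≤ a - ε * 1 := by nlinarith
    unfold sgnSet; split_ifs
    · rfl
    · linarith
    · simp
  · rcases le_total (a / ε) (-1) with h' | h'
    · have hs : sat ε a = -1 := by simp [sat, h, h']
      rw [hs]
      have : a - ε * (-1) ≤ 0 := by nlinarith
      unfold sgnSet; split_ifs
      · linarith
      · rfl
      · simp
    · have hs : sat ε a = a / ε := by simp [sat, h, h']
      rw [hs]
      have : a - ε * (a / ε) = 0 := by field_simp; simp
      rw [this]
      simpa [sgnSet] using ⟨h', h⟩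

lemma sat_bound (ε a : ℝ) : |sat ε a| ≤ 1 := by
  rw [abs_le]; unfold sat
  exact ⟨le_max_left _ _, max_le (by norm_num) (min_le_left _ _)⟩

lemma clip_abs (R a b : ℝ) : |max (-R) (min R a) - max (-R) (min R b)| ≤ |a - b| := by
  refine (abs_max_sub_max_le_max _ _ _ _).trans ?_
  simp only [sub_self, abs_zero]
  refine max_le (abs_nonneg _) ?_
  refine (abs_min_sub_min_le_max _ _ _ _).trans ?_
  simp

lemma sat_lip {ε : ℝ} (hε : 0 < ε) (a b : ℝ) : |sat ε a - sat ε b| ≤ |a - b| / ε := by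
  refine (clip_abs 1 _ _).trans ?_
  rw [← sub_div, abs_div, abs_of_pos hε]

/-- Coordinatewise truncation. -/
def clip {n : ℕ} (R : ℝ) (x : EuclideanSpace ℝ (Fin n)) : EuclideanSpace ℝ (Fin n) :=
  WithLp.toLp 2 fun i => max (-R) (min R (x i))

lemma clip_lip {n : ℕ} (R : ℝ) : LipschitzWith 1 (clip (n := n) R) := by
  refine LipschitzWith.of_dist_le_mul fun x y => ?_
  rw [NNReal.coe_one, one_mul, EuclideanSpace.dist_eq, EuclideanSpace.dist_eq]
  refine Real.sqrt_le_sqrt (Finset.sum_le_sum fun i _ => ?_)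
  refine pow_le_pow_left₀ dist_nonneg ?_ 2
  exact clip_abs R (x i) (y i)

lemma clip_norm {n : ℕ} {R : ℝ} (hR : 0 ≤ R) (x : EuclideanSpace ℝ (Fin n)) :
    ‖clip R x‖ ≤ ‖x‖ := by
  have h := (clip_lip (n := n) R).dist_le_mul x 0
  have h0 : clip R (0 : EuclideanSpace ℝ (Fin n)) = 0 := by
    ext i; simp [clip, hR]
  simpa [h0] using h

lemma clip_bound {n : ℕ} {R : ℝ} (hR : 0 ≤ R) (x : EuclideanSpace ℝ (Fin n)) :
    ‖clip R x‖ ≤ √(n * R ^ 2) := by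
  rw [EuclideanSpace.norm_eq]
  refine Real.sqrt_le_sqrt ?_
  calc ∑ i, ‖clip R x i‖ ^ 2 ≤ ∑ i : Fin n, R ^ 2 := by
        refine Finset.sum_le_sum fun i _ => pow_le_pow_left₀ (norm_nonneg _) ?_ 2
        rw [Real.norm_eq_abs, abs_le]
        exact ⟨le_max_left _ _, max_le (by linarith) (min_le_left _ _)⟩
    _ = _ := by simp

lemma clip_eq {n : ℕ} {R : ℝ} (x : EuclideanSpace ℝ (Fin n)) (hx : ‖x‖ ≤ R) :
    clip R x = x := by
  ext i
  have := abs_le.1 ((PiLp.norm_apply_le x i).trans hx)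
  simp [clip, this.1, this.2]

/-- Global existence for Lipschitz vector fields. -/
lemma global_ode {n : ℕ} (g : ℝ → EuclideanSpace ℝ (Fin n) → EuclideanSpace ℝ (Fin n))
    (K : NNReal) (hK : ∀ t, LipschitzWith K (g t)) (hc : ∀ x, Continuous fun t => g t x)
    {T : ℝ} (hT : 0 < T) {K' M : ℝ} (hK' : 0 ≤ K') (hM : 0 ≤ M)
    (hg : ∀ t x, ‖g t x‖ ≤ K' * ‖x‖ + M) (x₀ : EuclideanSpace ℝ (Fin n)) :
    ∃ α : ℝ → EuclideanSpace ℝ (Fin n), α 0 = x₀ ∧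
      (∀ t ∈ Icc 0 T, HasDerivWithinAt α (g t (α t)) (Icc 0 T) t) ∧
      ∀ t ∈ Icc 0 T, ‖α t‖ ≤ gronwallBound ‖x₀‖ K' M T := by
  set R := gronwallBound ‖x₀‖ K' M T with hR
  have hmono : Monotone (gronwallBound ‖x₀‖ K' M) := gronwallBound_mono (norm_nonneg _) hM hK'
  have hR0 : 0 ≤ R := by
    have := hmono hT.le
    rw [gronwallBound_x0] at this
    exact (norm_nonneg _).trans this
  set Lc : ℝ := K' * √(n * R ^ 2) + M with hLc
  have hL0 : 0 ≤ Lc := by positivity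
  have pl : IsPicardLindelof (fun t x => g t (clip R x)) (⟨0, le_rfl, hT.le⟩ : Icc (0 : ℝ) T) x₀
      ⟨Lc * T, by positivity⟩ 0 ⟨Lc, hL0⟩ (K * 1) := by
    refine ⟨fun t _ => ((hK t).comp (clip_lip R)).lipschitzOnWith, fun x _ => (hc _).continuousOn,
      fun t _ x _ => ?_, ?_⟩
    · refine (hg _ _).trans ?_
      show _ ≤ Lc
      have := clip_bound hR0 x
      rw [hLc]
      gcongr
    · simp [hT.le]
      exact le_rfl
  obtain ⟨α, h0, hα⟩ := pl.exists_eq_forall_mem_Icc_hasDerivWithinAt₀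
  have hb : ∀ t ∈ Icc 0 T, ‖α t‖ ≤ R := by
    intro t ht
    have := norm_le_gronwallBound_of_norm_deriv_right_le (f := α)
      (f' := fun t => g t (clip R (α t))) (δ := ‖x₀‖) (K := K') (ε := M) (a := 0) (b := T)
      (fun t ht => (hα t ht).continuousWithinAt)
      (fun t ht => (hα t ⟨ht.1, ht.2.le⟩).mono_of_mem_nhdsWithin
        (mem_of_superset (Icc_mem_nhdsGE ht.2) (Icc_subset_Icc_left ht.1)))
      (by rw [← h0]) (fun t ht => (hg _ _).trans (by
        have := clip_norm hR0 (α t)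
        gcongr)) t ht
    refine this.trans (hmono ?_)
    linarith [ht.2]
  refine ⟨α, h0, fun t ht => ?_, hb⟩
  have := hα t ht
  simp only [clip_eq _ (hb t ht)] at this
  exact this

/-- A.e. Gronwall inequality. -/
lemma ae_gronwall {W : ℝ → ℝ} {T k d : ℝ} (hd : 0 ≤ d) (hk : 0 ≤ k)
    (hW : ∃ K : NNReal, LipschitzOnWith K W (Icc 0 T)) (h0 : W 0 = 0)
    (hder : ∀ᵐ t ∂volume, t ∈ Ioo 0 T → ∃ w, HasDerivAt W w t ∧ w ≤ k * W t + d) :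
    ∀ t ∈ Icc 0 T, W t ≤ Real.exp (k * T) * (d * T) := by
  intro t ht
  obtain ⟨K, hK⟩ := hW
  have ac1 : AbsolutelyContinuousOnInterval W 0 t := by
    apply LipschitzOnWith.absolutelyContinuousOnInterval (K := K)
    rw [uIcc_of_le ht.1]
    exact hK.mono (Icc_subset_Icc_right ht.2)
  have ac2 : AbsolutelyContinuousOnInterval (fun s => Real.exp (-k * s)) 0 t :=
    ContDiffOn.absolutelyContinuousOnInterval (by fun_prop)
  have ac3 : AbsolutelyContinuousOnInterval (fun s => d * s) 0 t :=
    ContDiffOn.absolutelyContinuousOnInterval (by fun_prop)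
  have ac := (ac2.mul ac1).sub ac3
  have hint := ac.integral_deriv_eq_sub
  have hle : ∫ s in (0:ℝ)..t, deriv ((fun s => Real.exp (-k * s)) * W - fun s => d * s) s ≤ 0 := by
    rw [intervalIntegral.integral_of_le ht.1, integral_Ioc_eq_integral_Ioo]
    apply integral_nonpos_of_ae
    rw [EventuallyLE, ae_restrict_iff' measurableSet_Ioo]
    filter_upwards [hder] with s hs hsm
    obtain ⟨w, hw, hwle⟩ := hs ⟨hsm.1, hsm.2.trans_le ht.2⟩
    have h1 : HasDerivAt (fun s => Real.exp (-k * s)) (Real.exp (-k * s) * (-k)) s := by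
      have := ((hasDerivAt_id s).const_mul (-k)).exp
      simpa using this
    have h2 : HasDerivAt (fun s => d * s) d s := by
      simpa using (hasDerivAt_id s).const_mul d
    rw [((h1.mul hw).sub h2).deriv]
    have he : Real.exp (-k * s) ≤ 1 := Real.exp_le_one_iff.2 (by nlinarith [hsm.1])
    have hp := Real.exp_pos (-k * s)
    simp only [Pi.zero_apply]
    nlinarith
  rw [hint] at hle
  simp [h0] at hle
  have hp := Real.exp_pos (k * t)
  have e1 : Real.exp (k * t) * Real.exp (-(k * t)) = 1 := by
    rw [← Real.exp_add]; simp
  calc W t = Real.exp (k * t) * (Real.exp (-(k * t)) * W t) := by rw [← mul_assoc, e1, one_mul]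
    _ ≤ Real.exp (k * t) * (d * t) := by gcongr
    _ ≤ Real.exp (k * T) * (d * T) := by
      have := ht.1
      have := ht.2
      gcongr

/-- Solutions of the regularised inclusion (`ε = 0` is the original one). -/
def ASol {n m : ℕ} (b : Fin m → EuclideanSpace ℝ (Fin n))
    (A : EuclideanSpace ℝ (Fin n) →L[ℝ] EuclideanSpace ℝ (Fin n)) (ρ : Fin m → ℝ)
    (f : EuclideanSpace ℝ (Fin n) → EuclideanSpace ℝ (Fin n))
    (Γ : ℝ → EuclideanSpace ℝ (Fin n)) (T : ℝ) (x₀ : EuclideanSpace ℝ (Fin n)) (ε : ℝ)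
    (x : ℝ → EuclideanSpace ℝ (Fin n)) : Prop :=
  (∃ K : NNReal, LipschitzOnWith K x (Icc 0 T)) ∧ x 0 = x₀ ∧
    ∀ᵐ t ∂volume, t ∈ Ioo 0 T → ∃ σ : Fin m → ℝ,
      (∀ i, σ i ∈ sgnSet (⟪b i, A (x t)⟫ - ε * σ i)) ∧
      HasDerivAt x (f (x t) - (∑ i, (ρ i * σ i) • b i) + Γ t) t

lemma quad_lip {E : Type*} [NormedAddCommGroup E] [InnerProductSpace ℝ E] (A : E →L[ℝ] E)
    {e : ℝ → E} {T : ℝ} {K : NNReal} (he : LipschitzOnWith K e (Icc 0 T)) :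
    ∃ K' : NNReal, LipschitzOnWith K' (fun t => ⟪e t, A (e t)⟫) (Icc 0 T) := by
  obtain ⟨M, hM⟩ := isCompact_Icc.exists_bound_of_continuousOn he.continuousOn
  have hM' : ∀ t ∈ Icc 0 T, ‖e t‖ ≤ |M| := fun t ht => (hM t ht).trans (le_abs_self M)
  refine ⟨⟨2 * |M| * ‖A‖ * K, by positivity⟩, LipschitzOnWith.of_dist_le_mul fun s hs t ht => ?_⟩
  have h1 : ⟪e s, A (e s)⟫ - ⟪e t, A (e t)⟫ = ⟪e s - e t, A (e s)⟫ + ⟪e t, A (e s - e t)⟫ := by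
    rw [inner_sub_left, map_sub, inner_sub_right]; ring
  have h2 : ‖e s - e t‖ ≤ K * dist s t := by
    rw [← dist_eq_norm]; exact he.dist_le_mul s hs t ht
  have hKd : 0 ≤ K * dist s t := by positivity
  rw [Real.dist_eq, h1]
  show _ ≤ 2 * |M| * ‖A‖ * K * dist s t
  calc |⟪e s - e t, A (e s)⟫ + ⟪e t, A (e s - e t)⟫|
      ≤ ‖e s - e t‖ * ‖A (e s)‖ + ‖e t‖ * ‖A (e s - e t)‖ :=
        (abs_add_le _ _).trans (add_le_add (abs_real_inner_le_norm _ _)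
          (abs_real_inner_le_norm _ _))
    _ ≤ ‖e s - e t‖ * (‖A‖ * |M|) + |M| * (‖A‖ * ‖e s - e t‖) := by
        have := hM' s hs
        have := hM' t ht
        have h5 : ‖A (e s)‖ ≤ ‖A‖ * |M| := (A.le_opNorm _).trans (by gcongr)
        have h6 := A.le_opNorm (e s - e t)
        gcongr
    _ = 2 * |M| * ‖A‖ * ‖e s - e t‖ := by ring
    _ ≤ 2 * |M| * ‖A‖ * (K * dist s t) := by gcongr
    _ = _ := by ring

lemma stab {n m : ℕ} (b : Fin m → EuclideanSpace ℝ (Fin n))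
    (A : EuclideanSpace ℝ (Fin n) →L[ℝ] EuclideanSpace ℝ (Fin n))
    (hA : ∀ x y, ⟪A x, y⟫ = ⟪x, A y⟫) {c : ℝ} (hc : 0 < c) (hcA : ∀ x, c * ‖x‖ ^ 2 ≤ ⟪x, A x⟫)
    (ρ : Fin m → ℝ) (hρ : ∀ i, 0 < ρ i)
    (f : EuclideanSpace ℝ (Fin n) → EuclideanSpace ℝ (Fin n)) {L : NNReal}
    (hf : LipschitzWith L f) (Γ : ℝ → EuclideanSpace ℝ (Fin n)) {T : ℝ} (hT : 0 < T)
    (x₀ : EuclideanSpace ℝ (Fin n)) :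
    ∃ C : ℝ, 0 ≤ C ∧ ∀ ε δ : ℝ, 0 ≤ ε → 0 ≤ δ → ∀ x y, ASol b A ρ f Γ T x₀ ε x →
      ASol b A ρ f Γ T x₀ δ y → ∀ t ∈ Icc 0 T, ‖x t - y t‖ ^ 2 ≤ C * (ε + δ) := by
  have hρs : 0 ≤ ∑ i, ρ i := Finset.sum_nonneg fun i _ => (hρ i).le
  refine ⟨Real.exp ((2 * (L * ‖A‖ / c)) * T) * (4 * (∑ i, ρ i) * T) / c, by positivity, ?_⟩
  intro ε δ hε hδ x y ⟨⟨Kx, hKx⟩, hx0, hx⟩ ⟨⟨Ky, hKy⟩, hy0, hy⟩ t ht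
  have hlip : LipschitzOnWith (Kx + Ky) (fun t => x t - y t) (Icc 0 T) := hKx.sub hKy
  have key := ae_gronwall (W := fun t => ⟪x t - y t, A (x t - y t)⟫) (T := T)
    (k := 2 * (L * ‖A‖ / c)) (d := 4 * (∑ i, ρ i) * (ε + δ)) (by positivity) (by positivity)
    (quad_lip A hlip) (by simp [hx0, hy0]) ?_ t ht
  · have := (hcA (x t - y t)).trans key
    rw [div_mul_eq_mul_div, le_div_iff₀ hc]
    linarith
  · filter_upwards [hx, hy] with s hxs hys hs
    obtain ⟨σ, hσ, hdx⟩ := hxs hs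
    obtain ⟨τ, hτ, hdy⟩ := hys hs
    have hd := hdx.sub hdy
    have hdA := A.hasFDerivAt.comp_hasDerivAt s hd
    refine ⟨_, hd.inner ℝ hdA, ?_⟩
    simp only [Pi.sub_apply]
    set e := x s - y s with he
    set e' := f (x s) - (∑ i, (ρ i * σ i) • b i) + Γ s -
      (f (y s) - (∑ i, (ρ i * τ i) • b i) + Γ s) with he'
    have e1 : e' = (f (x s) - f (y s)) - ∑ i, (ρ i * (σ i - τ i)) • b i := by
      simp only [he', mul_sub, sub_smul, Finset.sum_sub_distrib]; abel
    have e2 : ⟪e', A e⟫ = ⟪f (x s) - f (y s), A e⟫ - ∑ i, ρ i * ((σ i - τ i) * ⟪b i, A e⟫) := by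
      rw [e1, inner_sub_left, sum_inner]
      congr 1
      refine Finset.sum_congr rfl fun i _ => ?_
      rw [real_inner_smul_left]; ring
    have e3 : ⟪e, A e'⟫ = ⟪e', A e⟫ := by rw [← hA, real_inner_comm]
    have i1 : ⟪f (x s) - f (y s), A e⟫ ≤ L * ‖A‖ / c * ⟪e, A e⟫ := by
      calc ⟪f (x s) - f (y s), A e⟫ ≤ ‖f (x s) - f (y s)‖ * ‖A e‖ := real_inner_le_norm _ _
        _ ≤ (L * ‖e‖) * (‖A‖ * ‖e‖) := by
          have h1 : ‖f (x s) - f (y s)‖ ≤ L * ‖e‖ := by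
            rw [he, ← dist_eq_norm, ← dist_eq_norm]; exact hf.dist_le_mul _ _
          have h2 := A.le_opNorm e
          gcongr
        _ = L * ‖A‖ / c * (c * ‖e‖ ^ 2) := by field_simp
        _ ≤ _ := by
          have := hcA e
          gcongr
    have i2 : ∀ i, -(2 * (ε + δ)) ≤ (σ i - τ i) * ⟪b i, A e⟫ := by
      intro i
      have hm := sgnSet_mono (hσ i) (hτ i)
      have h1 := abs_le.1 (sgnSet_bound (hσ i))
      have h2 := abs_le.1 (sgnSet_bound (hτ i))
      have : ⟪b i, A e⟫ = ⟪b i, A (x s)⟫ - ⟪b i, A (y s)⟫ := by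
        rw [he, map_sub, inner_sub_right]
      rw [this]
      have j1 : -2 ≤ (σ i - τ i) * σ i := by nlinarith
      have j2 : -2 ≤ -((σ i - τ i) * τ i) := by nlinarith
      nlinarith [mul_le_mul_of_nonneg_left j1 hε, mul_le_mul_of_nonneg_left j2 hδ]
    have i3 : -(2 * (∑ i, ρ i) * (ε + δ)) ≤ ∑ i, ρ i * ((σ i - τ i) * ⟪b i, A e⟫) := by
      calc -(2 * (∑ i, ρ i) * (ε + δ)) = ∑ i, ρ i * -(2 * (ε + δ)) := by
            rw [← Finset.sum_mul]; ring
        _ ≤ _ := Finset.sum_le_sum fun i _ => mul_le_mul_of_nonneg_left (i2 i) (hρ i).le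
    rw [e3, e2]
    linarith

lemma exists_approx {n m : ℕ} (b : Fin m → EuclideanSpace ℝ (Fin n))
    (A : EuclideanSpace ℝ (Fin n) →L[ℝ] EuclideanSpace ℝ (Fin n))
    (ρ : Fin m → ℝ) (hρ : ∀ i, 0 < ρ i)
    (f : EuclideanSpace ℝ (Fin n) → EuclideanSpace ℝ (Fin n)) {L : NNReal}
    (hf : LipschitzWith L f) (Γ : ℝ → EuclideanSpace ℝ (Fin n)) (hΓ : Continuous Γ) {G : ℝ}
    (hG : ∀ t, ‖Γ t‖ ≤ G) {T : ℝ} (hT : 0 < T) (x₀ : EuclideanSpace ℝ (Fin n)) :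
    ∃ K : NNReal, ∀ ε : ℝ, 0 < ε → ∃ x : ℝ → EuclideanSpace ℝ (Fin n),
      LipschitzOnWith K x (Icc 0 T) ∧ x 0 = x₀ ∧ ∀ t ∈ Ioo 0 T,
        HasDerivAt x (f (x t) - (∑ i, (ρ i * sat ε ⟪b i, A (x t)⟫) • b i) + Γ t) t := by
  have hG0 : 0 ≤ G := (norm_nonneg _).trans (hG 0)
  set M : ℝ := ‖f 0‖ + (∑ i, ρ i * ‖b i‖) + G with hM
  have hM0 : 0 ≤ M := by
    have : 0 ≤ ∑ i, ρ i * ‖b i‖ :=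
      Finset.sum_nonneg fun i _ => mul_nonneg (hρ i).le (norm_nonneg _)
    positivity
  have hgrow : ∀ ε t x, ‖f x - (∑ i, (ρ i * sat ε ⟪b i, A x⟫) • b i) + Γ t‖ ≤ L * ‖x‖ + M := by
    intro ε t x
    have h1 : ‖f x‖ ≤ L * ‖x‖ + ‖f 0‖ := by
      have := hf.dist_le_mul x 0
      rw [dist_eq_norm, dist_eq_norm, sub_zero] at this
      have h2 := norm_add_le (f x - f 0) (f 0)
      rw [sub_add_cancel] at h2
      linarith
    have h2 : ‖∑ i, (ρ i * sat ε ⟪b i, A x⟫) • b i‖ ≤ ∑ i, ρ i * ‖b i‖ := by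
      refine norm_sum_le_of_le _ fun i _ => ?_
      rw [norm_smul, Real.norm_eq_abs, abs_mul, abs_of_pos (hρ i)]
      have := sat_bound ε ⟪b i, A x⟫
      have := (hρ i).le
      calc ρ i * |sat ε ⟪b i, A x⟫| * ‖b i‖ ≤ ρ i * 1 * ‖b i‖ := by gcongr
        _ = _ := by ring
    have h3 := norm_add_le (f x - (∑ i, (ρ i * sat ε ⟪b i, A x⟫) • b i)) (Γ t)
    have h4 := norm_sub_le (f x) (∑ i, (ρ i * sat ε ⟪b i, A x⟫) • b i)
    linarith [hG t]
  have hR0 : 0 ≤ gronwallBound ‖x₀‖ L M T := by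
    have := gronwallBound_mono (norm_nonneg x₀) hM0 L.2 hT.le
    rw [gronwallBound_x0] at this
    exact (norm_nonneg _).trans this
  refine ⟨⟨L * gronwallBound ‖x₀‖ L M T + M, by positivity⟩, fun ε hε => ?_⟩
  have hS0 : 0 ≤ ∑ i, ρ i * (‖b i‖ * ‖A‖ / ε) * ‖b i‖ :=
    Finset.sum_nonneg fun i _ => by have := (hρ i).le; positivity
  obtain ⟨x, h0, hx, hb⟩ := global_ode
    (fun t x => f x - (∑ i, (ρ i * sat ε ⟪b i, A x⟫) • b i) + Γ t)
    (L + ⟨_, hS0⟩) (fun t => by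
      refine LipschitzWith.of_dist_le_mul fun x y => ?_
      rw [dist_eq_norm, dist_eq_norm]
      have e1 : f x - (∑ i, (ρ i * sat ε ⟪b i, A x⟫) • b i) + Γ t -
          (f y - (∑ i, (ρ i * sat ε ⟪b i, A y⟫) • b i) + Γ t) = (f x - f y) -
          ∑ i, (ρ i * (sat ε ⟪b i, A x⟫ - sat ε ⟪b i, A y⟫)) • b i := by
        simp only [mul_sub, sub_smul, Finset.sum_sub_distrib]; abel
      rw [e1]
      have h1 : ‖f x - f y‖ ≤ L * ‖x - y‖ := by
        rw [← dist_eq_norm, ← dist_eq_norm]; exact hf.dist_le_mul _ _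
      have h2 : ‖∑ i, (ρ i * (sat ε ⟪b i, A x⟫ - sat ε ⟪b i, A y⟫)) • b i‖ ≤
          (∑ i, ρ i * (‖b i‖ * ‖A‖ / ε) * ‖b i‖) * ‖x - y‖ := by
        rw [Finset.sum_mul]
        refine norm_sum_le_of_le _ fun i _ => ?_
        rw [norm_smul, Real.norm_eq_abs, abs_mul, abs_of_pos (hρ i)]
        have hs := sat_lip hε ⟪b i, A x⟫ ⟪b i, A y⟫
        rw [← inner_sub_right, ← map_sub] at hs
        have h4 : |⟪b i, A (x - y)⟫| ≤ ‖b i‖ * (‖A‖ * ‖x - y‖) :=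
          (abs_real_inner_le_norm _ _).trans (by
            have := A.le_opNorm (x - y)
            gcongr)
        have := (hρ i).le
        calc ρ i * |sat ε ⟪b i, A x⟫ - sat ε ⟪b i, A y⟫| * ‖b i‖
            ≤ ρ i * (‖b i‖ * (‖A‖ * ‖x - y‖) / ε) * ‖b i‖ := by
              have h5 := hs.trans (div_le_div_of_nonneg_right h4 hε.le)
              gcongr
          _ = _ := by ring
      refine (norm_sub_le _ _).trans ((add_le_add h1 h2).trans (le_of_eq ?_))
      rw [← add_mul]; rfl)
    (fun x => by fun_prop) hT L.2 hM0 (hgrow ε) x₀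
  refine ⟨x, ?_, h0, fun t ht => (hx t ⟨ht.1.le, ht.2.le⟩).hasDerivAt (Icc_mem_nhds ht.1 ht.2)⟩
  refine (convex_Icc 0 T).lipschitzOnWith_of_nnnorm_hasDerivWithin_le hx fun t ht => ?_
  refine NNReal.coe_le_coe.1 ?_
  refine (hgrow ε t (x t)).trans ?_
  show _ ≤ L * gronwallBound ‖x₀‖ L M T + M
  have := hb t ht
  exact add_le_add (mul_le_mul_of_nonneg_left this L.2) le_rfl

lemma limit_sol {n m : ℕ} (b : Fin m → EuclideanSpace ℝ (Fin n))
    (A : EuclideanSpace ℝ (Fin n) →L[ℝ] EuclideanSpace ℝ (Fin n))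
    (ρ : Fin m → ℝ)
    (f : EuclideanSpace ℝ (Fin n) → EuclideanSpace ℝ (Fin n)) (hf : Continuous f)
    (Γ : ℝ → EuclideanSpace ℝ (Fin n)) (hΓ : Continuous Γ) {T : ℝ}
    (K : NNReal) (ε : ℕ → ℝ) (hε : ∀ k, 0 < ε k) (hε0 : Tendsto ε atTop (𝓝 0))
    (X : ℕ → ℝ → EuclideanSpace ℝ (Fin n)) (hX : ∀ k, LipschitzOnWith K (X k) (Icc 0 T))
    (hXd : ∀ k, ∀ t ∈ Ioo 0 T, HasDerivAt (X k)
      (f (X k t) - (∑ i, (ρ i * sat (ε k) ⟪b i, A (X k t)⟫) • b i) + Γ t) t)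
    (x : ℝ → EuclideanSpace ℝ (Fin n))
    (hx : ∀ t ∈ Icc 0 T, Tendsto (fun k => X k t) atTop (𝓝 (x t)))
    {t : ℝ} (ht : t ∈ Ioo 0 T) {v : EuclideanSpace ℝ (Fin n)} (hv : HasDerivAt x v t) :
    ∃ σ : Fin m → ℝ, (∀ i, σ i ∈ sgnSet ⟪b i, A (x t)⟫) ∧
      v = f (x t) - (∑ i, (ρ i * σ i) • b i) + Γ t := by
  set Q : Set (Fin m → ℝ) := Set.pi univ fun i => sgnSet ⟪b i, A (x t)⟫ with hQ
  set lin : (Fin m → ℝ) →ₗ[ℝ] EuclideanSpace ℝ (Fin n) :=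
    ∑ i, (LinearMap.proj (R := ℝ) (φ := fun _ : Fin m => ℝ) i).smulRight (ρ i • b i) with hlin
  have hlin' : ∀ σ, lin σ = ∑ i, (ρ i * σ i) • b i := by
    intro σ
    simp [hlin, smul_smul, mul_comm]
  have hQc : IsCompact (lin '' Q) :=
    (isCompact_univ_pi fun i => sgnSet_compact _).image lin.continuous_of_finiteDimensional
  have hQv : Convex ℝ (lin '' Q) := (convex_pi fun i _ => sgnSet_convex _).linear_image lin
  set w := f (x t) + Γ t - v with hw
  suffices hmem : w ∈ lin '' Q by
    obtain ⟨σ, hσ, hσw⟩ := hmem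
    refine ⟨σ, fun i => hσ i (mem_univ i), ?_⟩
    rw [← hlin', hσw, hw]; abel
  by_contra hnot
  obtain ⟨ℓ, u, hlu, huw⟩ := geometric_hahn_banach_closed_point hQv hQc.isClosed hnot
  -- joint convergence
  have hjoint : Tendsto (fun p : ℕ × ℝ => X p.1 p.2) (atTop ×ˢ 𝓝 t) (𝓝 (x t)) := by
    have htI : t ∈ Icc 0 T := ⟨ht.1.le, ht.2.le⟩
    rw [tendsto_iff_dist_tendsto_zero]
    have hlim : Tendsto (fun p : ℕ × ℝ => K * dist p.2 t + dist (X p.1 t) (x t))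
        (atTop ×ˢ 𝓝 t) (𝓝 (K * dist t t + 0)) := by
      refine Tendsto.add ?_ ((tendsto_iff_dist_tendsto_zero.1 (hx t htI)).comp tendsto_fst)
      exact ((continuous_const.mul (continuous_id.dist continuous_const)).tendsto t).comp
        tendsto_snd
    rw [dist_self, mul_zero, add_zero] at hlim
    refine squeeze_zero' (Eventually.of_forall fun _ => dist_nonneg) ?_ hlim
    have : ∀ᶠ p : ℕ × ℝ in atTop ×ˢ 𝓝 t, p.2 ∈ Ioo 0 T :=
      tendsto_snd.eventually (Ioo_mem_nhds ht.1 ht.2)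
    filter_upwards [this] with p hp
    exact (dist_triangle _ (X p.1 t) _).trans
      (add_le_add ((hX p.1).dist_le_mul _ ⟨hp.1.le, hp.2.le⟩ _ htI) le_rfl)
  have hσ : ∀ᶠ p : ℕ × ℝ in atTop ×ˢ 𝓝 t, ∀ i,
      sat (ε p.1) ⟪b i, A (X p.1 p.2)⟫ ∈ sgnSet ⟪b i, A (x t)⟫ := by
    rw [eventually_all]
    intro i
    have h1 : Tendsto (fun p : ℕ × ℝ => ⟪b i, A (X p.1 p.2)⟫) (atTop ×ˢ 𝓝 t)
        (𝓝 ⟪b i, A (x t)⟫) := by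
      have hcont : Continuous fun z : EuclideanSpace ℝ (Fin n) => ⟪b i, A z⟫ := by fun_prop
      exact (hcont.tendsto _).comp hjoint
    have h2 : Tendsto (fun p : ℕ × ℝ => ε p.1 * sat (ε p.1) ⟪b i, A (X p.1 p.2)⟫)
        (atTop ×ˢ 𝓝 t) (𝓝 0) := by
      refine squeeze_zero_norm (fun p => ?_) (hε0.comp tendsto_fst)
      rw [norm_mul, Real.norm_eq_abs, Real.norm_eq_abs, abs_of_pos (hε _)]
      exact mul_le_of_le_one_right (hε _).le (sat_bound _ _)
    have h3 := h1.sub h2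
    rw [sub_zero] at h3
    filter_upwards [h3.eventually (sgnSet_usc _)] with p hp
    exact hp (sat_mem (hε _) _)
  have herr : Tendsto (fun p : ℕ × ℝ => ℓ (f (X p.1 p.2) + Γ p.2)) (atTop ×ˢ 𝓝 t)
      (𝓝 (ℓ (f (x t) + Γ t))) :=
    (ℓ.continuous.tendsto _).comp
      (((hf.tendsto _).comp hjoint).add ((hΓ.tendsto t).comp tendsto_snd))
  set q := ℓ (f (x t) + Γ t) with hq
  have hlw : ℓ w = q - ℓ v := by rw [hw, map_sub]
  -- lower slope bound
  have hlow : ∀ᶠ p : ℕ × ℝ in atTop ×ˢ 𝓝 t, (ℓ v + (q - u)) / 2 <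
      ℓ (f (X p.1 p.2) - (∑ i, (ρ i * sat (ε p.1) ⟪b i, A (X p.1 p.2)⟫) • b i) + Γ p.2) := by
    have hlt : q - (q - u - ℓ v) / 2 < q := by linarith
    filter_upwards [hσ, herr.eventually (lt_mem_nhds hlt)] with p hp1 hp2
    have h1 := hlu _ (mem_image_of_mem lin (show _ ∈ Q from fun i _ => hp1 i))
    rw [hlin'] at h1
    rw [map_add] at hp2
    rw [map_add, map_sub]
    linarith
  obtain ⟨U, hU, V, hV, hUV⟩ := eventually_prod_iff.1 hlow
  obtain ⟨N, hN⟩ := eventually_atTop.1 hU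
  obtain ⟨η, hη, hball⟩ := Metric.eventually_nhds_iff.1 (hV.and (Ioo_mem_nhds ht.1 ht.2))
  set μ := (ℓ v + (q - u)) / 2 with hμ
  have hslope : ∀ᶠ s in 𝓝[>] t, μ ≤ slope (fun s => ℓ (x s)) t s := by
    filter_upwards [Ioo_mem_nhdsGT (show t < t + η by linarith)] with s hs
    have hin : ∀ r ∈ Icc t s, V r ∧ r ∈ Ioo 0 T := fun r hr => hball (by
      rw [Real.dist_eq, abs_of_nonneg (by linarith [hr.1])]; linarith [hr.2, hs.2])
    have hk : ∀ k ≥ N, μ * (s - t) ≤ ℓ (X k s) - ℓ (X k t) := by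
      intro k hk
      have hd : ∀ r ∈ Icc t s, HasDerivAt (fun r => ℓ (X k r))
          (ℓ (f (X k r) - (∑ i, (ρ i * sat (ε k) ⟪b i, A (X k r)⟫) • b i) + Γ r)) r :=
        fun r hr => ℓ.hasFDerivAt.comp_hasDerivAt r (hXd k r (hin r hr).2)
      refine Convex.mul_sub_le_image_sub_of_le_deriv (convex_Icc t s)
        (fun r hr => (hd r hr).continuousAt.continuousWithinAt)
        (fun r hr => (hd r (interior_subset hr)).differentiableAt.differentiableWithinAt)
        (fun r hr => ?_) t (left_mem_Icc.2 hs.1.le) s (right_mem_Icc.2 hs.1.le) hs.1.le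
      rw [(hd r (interior_subset hr)).deriv]
      exact (hUV (hN k hk) (hin r (interior_subset hr)).1).le
    have hl : ∀ r ∈ Icc t s, Tendsto (fun k => ℓ (X k r)) atTop (𝓝 (ℓ (x r))) := fun r hr =>
      (ℓ.continuous.tendsto _).comp (hx r (Ioo_subset_Icc_self (hin r hr).2))
    have hfin : μ * (s - t) ≤ ℓ (x s) - ℓ (x t) :=
      ge_of_tendsto ((hl s (right_mem_Icc.2 hs.1.le)).sub (hl t (left_mem_Icc.2 hs.1.le)))
        (eventually_atTop.2 ⟨N, hk⟩)
    rw [slope_def_field, le_div_iff₀ (by linarith [hs.1])]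
    exact hfin
  have hvd : HasDerivAt (fun s => ℓ (x s)) (ℓ v) t := ℓ.hasFDerivAt.comp_hasDerivAt t hv
  have hts : Tendsto (slope (fun s => ℓ (x s)) t) (𝓝[>] t) (𝓝 (ℓ v)) :=
    (hasDerivAt_iff_tendsto_slope.1 hvd).mono_left
    (nhdsWithin_mono t (fun s (hs : t < s) => ne_of_gt hs))
  have := ge_of_tendsto hts hslope
  linarith

lemma exists_sol {n m : ℕ} (b : Fin m → EuclideanSpace ℝ (Fin n))
    (A : EuclideanSpace ℝ (Fin n) →L[ℝ] EuclideanSpace ℝ (Fin n))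
    (hA : ∀ x y, ⟪A x, y⟫ = ⟪x, A y⟫) {c : ℝ} (hc : 0 < c) (hcA : ∀ x, c * ‖x‖ ^ 2 ≤ ⟪x, A x⟫)
    (ρ : Fin m → ℝ) (hρ : ∀ i, 0 < ρ i)
    (f : EuclideanSpace ℝ (Fin n) → EuclideanSpace ℝ (Fin n)) {L : NNReal}
    (hf : LipschitzWith L f) (Γ : ℝ → EuclideanSpace ℝ (Fin n)) (hΓ : Continuous Γ) {G : ℝ}
    (hG : ∀ t, ‖Γ t‖ ≤ G) {T : ℝ} (hT : 0 < T) (x₀ : EuclideanSpace ℝ (Fin n)) :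
    ∃ x, ASol b A ρ f Γ T x₀ 0 x := by
  obtain ⟨K, hK⟩ := exists_approx b A ρ hρ f hf Γ hΓ hG hT x₀
  obtain ⟨C, hC0, hC⟩ := stab b A hA hc hcA ρ hρ f hf Γ hT x₀
  set ε : ℕ → ℝ := fun k => 1 / ((k : ℝ) + 1) with hεdef
  have hε : ∀ k, 0 < ε k := fun k => by simp only [hεdef]; positivity
  have hε0 : Tendsto ε atTop (𝓝 0) := tendsto_one_div_add_atTop_nhds_zero_nat
  choose X hX hX0 hXd using fun k => hK (ε k) (hε k)
  have hsol : ∀ k, ASol b A ρ f Γ T x₀ (ε k) (X k) := fun k =>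
    ⟨⟨K, hX k⟩, hX0 k, Eventually.of_forall fun t ht =>
      ⟨_, fun i => sat_mem (hε k) _, hXd k t ht⟩⟩
  have hcau : ∀ t, ∃ z, t ∈ Icc 0 T → Tendsto (fun k => X k t) atTop (𝓝 z) := by
    intro t
    by_cases ht : t ∈ Icc 0 T
    · have : CauchySeq fun k => X k t := by
        refine cauchySeq_of_le_tendsto_0 (fun k => √(C * (ε k + ε k))) (fun k l N hk hl => ?_) ?_
        · rw [dist_eq_norm]
          refine Real.le_sqrt_of_sq_le ((hC _ _ (hε k).le (hε l).le _ _ (hsol k) (hsol l) t ht).trans ?_)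
          have h1 : ε k ≤ ε N := Nat.one_div_le_one_div hk
          have h2 : ε l ≤ ε N := Nat.one_div_le_one_div hl
          gcongr
        · have : Tendsto (fun k => √(C * (ε k + ε k))) atTop (𝓝 √(C * (0 + 0))) :=
            (Real.continuous_sqrt.tendsto _).comp ((hε0.add hε0).const_mul C)
          simpa using this
      obtain ⟨z, hz⟩ := cauchySeq_tendsto_of_complete this
      exact ⟨z, fun _ => hz⟩
    · exact ⟨0, fun h => absurd h ht⟩
  choose x hx using hcau
  have hxl : LipschitzOnWith K x (Icc 0 T) := by
    refine LipschitzOnWith.of_dist_le_mul fun s hs t ht => ?_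
    exact le_of_tendsto ((hx s hs).dist (hx t ht))
      (Eventually.of_forall fun k => (hX k).dist_le_mul s hs t ht)
  refine ⟨x, ⟨K, hxl⟩, ?_, ?_⟩
  · have h0 := hx 0 ⟨le_rfl, hT.le⟩
    simp only [hX0] at h0
    exact tendsto_nhds_unique h0 tendsto_const_nhds
  · have hd := hxl.ae_differentiableWithinAt_real measurableSet_Icc
    rw [ae_restrict_iff' measurableSet_Icc] at hd
    filter_upwards [hd] with t ht hti
    have hda := (ht ⟨hti.1.le, hti.2.le⟩).differentiableAt (Icc_mem_nhds hti.1 hti.2)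
    obtain ⟨σ, hσ, hv⟩ := limit_sol b A ρ f hf.continuous Γ hΓ K ε hε hε0 X hX hXd x hx hti
      hda.hasDerivAt
    refine ⟨σ, fun i => by simpa using hσ i, ?_⟩
    rw [← hv]
    exact hda.hasDerivAt

lemma exists_coercive {n : ℕ} (A : EuclideanSpace ℝ (Fin n) →L[ℝ] EuclideanSpace ℝ (Fin n))
    (hpos : ∀ x, x ≠ 0 → 0 < ⟪x, A x⟫) : ∃ c : ℝ, 0 < c ∧ ∀ x, c * ‖x‖ ^ 2 ≤ ⟪x, A x⟫ := by
  rcases (Metric.sphere (0 : EuclideanSpace ℝ (Fin n)) 1).eq_empty_or_nonempty with he | hne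
  · refine ⟨1, one_pos, fun x => ?_⟩
    by_cases hx : x = 0
    · simp [hx]
    · have : ‖x‖⁻¹ • x ∈ Metric.sphere (0 : EuclideanSpace ℝ (Fin n)) 1 := by
        simp [norm_smul, hx]
      rw [he] at this
      exact this.elim
  · obtain ⟨z, hz, hmin⟩ := (isCompact_sphere (0 : EuclideanSpace ℝ (Fin n)) 1).exists_isMinOn hne
      (f := fun x => ⟪x, A x⟫) (by fun_prop)
    have hz0 : z ≠ 0 := by
      rintro rfl
      simp at hz
    refine ⟨_, hpos z hz0, fun x => ?_⟩
    by_cases hx : x = 0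
    · simp [hx]
    · have hm : ‖x‖⁻¹ • x ∈ Metric.sphere (0 : EuclideanSpace ℝ (Fin n)) 1 := by
        simp [norm_smul, hx]
      have h1 : ⟪z, A z⟫ ≤ ⟪‖x‖⁻¹ • x, A (‖x‖⁻¹ • x)⟫ := hmin hm
      rw [map_smul, real_inner_smul_left, real_inner_smul_right] at h1
      have hn : 0 < ‖x‖ := norm_pos_iff.2 hx
      calc ⟪z, A z⟫ * ‖x‖ ^ 2 ≤ ‖x‖⁻¹ * (‖x‖⁻¹ * ⟪x, A x⟫) * ‖x‖ ^ 2 := by gcongr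
        _ = ⟪x, A x⟫ := by field_simp

end Helpers

/-- Well-posedness of the Lyapunov-based discontinuous robust closed-loop inclusion
`ẋ(t) ∈ f(x(t)) - Σᵢ ρᵢ B_{•i} sgn(B_{•i}ᵀ P x(t)) + Σᵢ B_{•i} γᵢ(t)`:
for `P` symmetric positive definite, `f` Lipschitz and a differentiable bounded
disturbance `γ` with square-integrable derivative, there is a unique Lipschitz solution
on `[0,T]` for every initial condition. -/
theorem lyapunovBased_inclusion_existsUnique_lipschitzSolution
    (n m : ℕ) (T : ℝ) (hT : 0 < T)
    (B : Matrix (Fin n) (Fin m) ℝ)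
    (P : Matrix (Fin n) (Fin n) ℝ) (hPsymm : P.IsSymm) (hPpos : P.PosDef)
    (ρ : Fin m → ℝ) (hρ : ∀ i, 0 < ρ i)
    (f : EuclideanSpace ℝ (Fin n) → EuclideanSpace ℝ (Fin n))
    (hf : ∃ K : NNReal, LipschitzWith K f)
    (γ : ℝ → EuclideanSpace ℝ (Fin m)) (hγdiff : Differentiable ℝ γ)
    (hγL2 : MemLp (deriv γ) 2 (volume.restrict (Ioo 0 T)))
    (hγbound : ∀ t : ℝ, ∀ i : Fin m, |γ t i| < ρ i)
    (x₀ : EuclideanSpace ℝ (Fin n)) :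
    ∃ x : ℝ → EuclideanSpace ℝ (Fin n),
      IsLipschitzSolution
        (fun t ξ => {v | ∃ σ : Fin m → ℝ,
          (∀ i, σ i ∈ sgnSet ⟪col B i, mv P ξ⟫) ∧
          v = f ξ - (∑ i, (ρ i * σ i) • col B i) + ∑ i, γ t i • col B i}) T x₀ x ∧
      ∀ y : ℝ → EuclideanSpace ℝ (Fin n),
        IsLipschitzSolution
          (fun t ξ => {v | ∃ σ : Fin m → ℝ,
            (∀ i, σ i ∈ sgnSet ⟪col B i, mv P ξ⟫) ∧
            v = f ξ - (∑ i, (ρ i * σ i) • col B i) + ∑ i, γ t i • col B i}) T x₀ y →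
        ∀ t ∈ Icc (0 : ℝ) T, y t = x t := by
  obtain ⟨L, hL⟩ := hf
  set A : EuclideanSpace ℝ (Fin n) →L[ℝ] EuclideanSpace ℝ (Fin n) :=
    Matrix.toEuclideanCLM (𝕜 := ℝ) P with hAdef
  have hAmv : ∀ x, mv P x = A x := by
    intro x
    ext i
    simp [mv, hAdef, Matrix.ofLp_toEuclideanCLM, Matrix.mulVec, dotProduct]
  have hinner : ∀ x y : EuclideanSpace ℝ (Fin n), ⟪x, A y⟫ = ∑ i, ∑ j, x i * P i j * y j := by
    intro x y
    rw [← hAmv, PiLp.inner_apply]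
    refine Finset.sum_congr rfl fun i _ => ?_
    simp only [mv, RCLike.inner_apply, conj_trivial]
    rw [Finset.sum_mul]
    exact Finset.sum_congr rfl fun j _ => by ring
  have hsymm : ∀ x y, ⟪A x, y⟫ = ⟪x, A y⟫ := by
    intro x y
    rw [real_inner_comm, hinner, hinner, Finset.sum_comm]
    refine Finset.sum_congr rfl fun i _ => Finset.sum_congr rfl fun j _ => ?_
    rw [hPsymm.apply]; ring
  have hpos : ∀ x, x ≠ 0 → 0 < ⟪x, A x⟫ := by
    intro x hx
    have h0 : (WithLp.ofLp x) ≠ 0 := by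
      simpa using hx
    have := hPpos.dotProduct_mulVec_pos h0
    rw [hinner]
    simpa [dotProduct, Matrix.mulVec, Finset.mul_sum, mul_assoc] using this
  obtain ⟨c, hc, hcA⟩ := exists_coercive A hpos
  set Γ : ℝ → EuclideanSpace ℝ (Fin n) := fun t => ∑ i, γ t i • col B i with hΓdef
  have hγc : Continuous γ := hγdiff.continuous
  have hΓ : Continuous Γ := by fun_prop
  have hG : ∀ t, ‖Γ t‖ ≤ ∑ i, ρ i * ‖col B i‖ := by
    intro t
    refine norm_sum_le_of_le _ fun i _ => ?_
    rw [norm_smul, Real.norm_eq_abs]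
    have := (hγbound t i).le
    gcongr
  have hconv : ∀ y : ℝ → EuclideanSpace ℝ (Fin n), IsLipschitzSolution
      (fun t ξ => {v | ∃ σ : Fin m → ℝ,
          (∀ i, σ i ∈ sgnSet ⟪col B i, mv P ξ⟫) ∧
          v = f ξ - (∑ i, (ρ i * σ i) • col B i) + ∑ i, γ t i • col B i}) T x₀ y ↔
      ASol (col B) A ρ f Γ T x₀ 0 y := by
    intro y
    unfold IsLipschitzSolution ASol
    refine and_congr Iff.rfl (and_congr Iff.rfl (eventually_congr
      (Eventually.of_forall fun t => imp_congr Iff.rfl ?_)))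
    constructor
    · rintro ⟨v, ⟨σ, hσ, rfl⟩, hv⟩
      exact ⟨σ, fun i => by simpa [hAmv] using hσ i, hv⟩
    · rintro ⟨σ, hσ, hv⟩
      exact ⟨_, ⟨σ, fun i => by simpa [hAmv] using hσ i, rfl⟩, hv⟩
  obtain ⟨x, hx⟩ := exists_sol (col B) A hsymm hc hcA ρ hρ f hL Γ hΓ hG hT x₀
  obtain ⟨C, -, hC⟩ := stab (col B) A hsymm hc hcA ρ hρ f hL Γ hT x₀
  refine ⟨x, (hconv x).2 hx, fun y hy t ht => ?_⟩
  have h := hC 0 0 le_rfl le_rfl y x ((hconv y).1 hy) hx t ht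
  simp only [add_zero, mul_zero] at h
  have h2 : ‖y t - x t‖ = 0 := by
    have := sq_nonneg ‖y t - x t‖
    exact pow_eq_zero_iff (two_ne_zero) |>.1 (le_antisymm h this)
  exact sub_eq_zero.1 (norm_eq_zero.1 h2)
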